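/- Let G be a soluble-by-finite group with the property K̄∞, and let N be an infinite normal subgroup of G. Then the commutator subgroup of the quotient group G/N is finite. -/

import Mathlib

/-- A group `G` has property K̄∞ if for every subgroup `X` of `G` the set of
subgroups of the form `⁅X, H⁆`, with `H` ranging over infinite subgroups of `G`,
is finite. -/
def PropKInf (G : Type*) [Group G] : Prop :=
  ∀ X : Subgroup G, {S : Subgroup G | ∃ H : Subgroup G, Infinite H ∧ S = ⁅X, H⁆}.Finite

/-- A group is soluble-by-finite if it has a solvable normal subgroup of finite index. -/
def SolubleByFinite (G : Type*) [Group G] : Prop :=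
  ∃ N : Subgroup G, N.Normal ∧ IsSolvable N ∧ N.FiniteIndex

open scoped Pointwise commutatorElement

theorem aux_jac : IsJacobsonRing ℤ := by
  rw [isJacobsonRing_iff_prime_eq]
  intro P hP
  by_cases hb : P = ⊥
  · subst hb
    rw [eq_bot_iff]
    intro x hx
    have h1 := Ideal.mem_jacobson_bot.1 hx x
    rw [Int.isUnit_iff] at h1
    have : x = 0 := by rcases h1 with h1 | h1 <;> nlinarith
    simpa using this
  · have := hP.isMaximal hb
    exact Ideal.jacobson_eq_self_of_isMaximal

theorem aux_field {K : Type*} [Field K] [Algebra.FiniteType ℤ K] : Finite K := by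
  have := aux_jac
  have hfin : Module.Finite ℤ K := finite_of_finite_type_of_isJacobsonRing ℤ K
  by_cases h0 : CharZero K
  · exfalso
    have hinj : Function.Injective (algebraMap ℤ K) := by
      simpa using (Int.cast_injective (α := K))
    have hint : Algebra.IsIntegral ℤ K := inferInstance
    exact Int.not_isField (isField_of_isIntegral_of_isField hinj (Field.toIsField K))
  · obtain ⟨p, hp⟩ := CharP.exists K
    have hp0 : p ≠ 0 := by
      rintro rfl
      exact h0 (CharP.charP_to_charZero K)
    apply Module.finite_of_fg_torsion
    intro x
    refine ⟨⟨(p : ℤ), by simpa using hp0⟩, ?_⟩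
    simp [Submonoid.smul_def]

theorem aux_simple {R M : Type*} [CommRing R] [Algebra.FiniteType ℤ R] [AddCommGroup M]
    [Module R M] [IsSimpleModule R M] : Finite M := by
  obtain ⟨I, hI, ⟨e⟩⟩ := isSimpleModule_iff_quot_maximal.mp ‹IsSimpleModule R M›
  have hft : Algebra.FiniteType ℤ (R ⧸ I) :=
    Algebra.FiniteType.of_surjective (Ideal.Quotient.mkₐ ℤ I) (Ideal.Quotient.mkₐ_surjective ℤ I)
  let : Field (R ⧸ I) := Ideal.Quotient.field I
  have : Finite (R ⧸ I) := @aux_field _ _ hft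
  exact Finite.of_equiv _ e.symm.toEquiv

theorem aux_sub {R M : Type*} [CommRing R] [Algebra.FiniteType ℤ R] [AddCommGroup M]
    [Module R M] (B : Submodule R M) (h : (Set.Iic B).Finite) : Finite B := by
  have key : ∀ n : ℕ, ∀ C : Submodule R M, (Set.Iic C).Finite → (Set.Iic C).ncard ≤ n → Finite C := by
    intro n
    induction n with
    | zero =>
      intro C hC hn
      exfalso
      have := (Set.ncard_eq_zero hC).1 (by omega)
      have h2 : C ∈ Set.Iic C := le_refl C
      rw [this] at h2
      exact h2
    | succ n ih =>
      intro C hC hn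
      by_cases hb : C = ⊥
      · subst hb; infer_instance
      have hne : (Set.Iio C).Nonempty := ⟨⊥, bot_lt_iff_ne_bot.2 hb⟩
      have hfio : (Set.Iio C).Finite := hC.subset Set.Iio_subset_Iic_self
      obtain ⟨E, hE⟩ := hfio.exists_maximal hne
      have hcov : E ⋖ C := by
        refine ⟨hE.1, fun F h1 h2 => ?_⟩
        exact absurd (hE.2 (show F ∈ Set.Iio C from h2) h1.le) (not_le_of_gt h1)
      have hsimple := (covBy_iff_quot_is_simple hcov.le).1 hcov
      have hq : Finite (C ⧸ Submodule.comap C.subtype E) := aux_simple (R := R)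
      have hlt : (Set.Iic E) ⊂ Set.Iic C :=
        ⟨Set.Iic_subset_Iic.2 hcov.le, fun hh => not_le_of_gt hcov.lt (Set.Iic_subset_Iic.1 hh)⟩
      have hEfin : Finite E := ih E (hC.subset hlt.1) (by
        have := Set.ncard_lt_ncard hlt hC
        omega)
      have : Finite (Submodule.comap C.subtype E) :=
        Finite.of_injective (fun z => (⟨z.1.1, z.2⟩ : E)) (by
          rintro ⟨⟨a, ha⟩, ha'⟩ ⟨⟨b, hb⟩, hb'⟩ hab
          have := congrArg (fun z : E => z.1) hab
          simpa only [Subtype.mk.injEq] using this)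
      have h1 : Finite (Submodule.comap C.subtype E).toAddSubgroup := this
      have h2 : Finite (C ⧸ (Submodule.comap C.subtype E).toAddSubgroup) := hq
      exact Finite.of_equiv _ (AddSubgroup.addGroupEquivQuotientProdAddSubgroup
        (s := (Submodule.comap C.subtype E).toAddSubgroup)).symm
  exact key _ B h le_rfl

theorem aux_schur {Q : Type*} [Group Q] (S : Subgroup Q) [S.FiniteIndex]
    (h : S ≤ Subgroup.center Q) : Finite (commutator Q) := by
  have : (Subgroup.center Q).FiniteIndex := Subgroup.finiteIndex_of_le h
  have hc : Finite (commutatorSet Q) := by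
    have hf : Finite (Q ⧸ Subgroup.center Q) := inferInstance
    have : commutatorSet Q ⊆ Set.range (fun p : (Q ⧸ Subgroup.center Q) × (Q ⧸ Subgroup.center Q) =>
        ⁅p.1.out, p.2.out⁆) := by
      rintro _ ⟨a, b, rfl⟩
      refine ⟨(a, b), ?_⟩
      obtain ⟨z, hz⟩ := QuotientGroup.mk_out_eq_mul (Subgroup.center Q) a
      obtain ⟨w, hw⟩ := QuotientGroup.mk_out_eq_mul (Subgroup.center Q) b
      simp only [hz, hw]
      have h1 := Subgroup.mem_center_iff.1 z.2
      have h2 := Subgroup.mem_center_iff.1 w.2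
      simp only [commutatorElement_def, mul_inv_rev]
      calc _ = a * (z * (b * w) * (z:Q)⁻¹) * a⁻¹ * (w:Q)⁻¹ * b⁻¹ := by group
        _ = a * b * (w * a⁻¹ * (w:Q)⁻¹) * b⁻¹ := by rw [← h1]; group
        _ = _ := by rw [← h2]; group
    exact (Set.finite_range _).subset this
  infer_instance

theorem aux_zp {Q : Type*} [Group Q] (C M : Subgroup Q) (x : Q) 
    (hx : ∀ c, c ∈ C ↔ x * c * x⁻¹ ∈ C) (h : ∀ m ∈ M, ⁅x, m⁆ ∈ C) :
    ⁅M, Subgroup.zpowers x⁆ ≤ C := by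
  let L : Subgroup Q := 
    { carrier := {g | g ∈ Subgroup.normalizer (C : Set Q) ∧ ∀ m ∈ M, ⁅g, m⁆ ∈ C}
      one_mem' := ⟨one_mem _, fun m _ => by simp⟩
      mul_mem' := by
        rintro a b ⟨ha, ha'⟩ ⟨hb, hb'⟩
        refine ⟨mul_mem ha hb, fun m hm => ?_⟩
        have := mul_mem ((Subgroup.mem_normalizer_iff.1 ha _).1 (hb' m hm)) (ha' m hm)
        convert this using 1
        simp only [commutatorElement_def]; group
      inv_mem' := by
        rintro a ⟨ha, ha'⟩
        refine ⟨inv_mem ha, fun m hm => ?_⟩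
        have := (Subgroup.mem_normalizer_iff.1 (inv_mem ha) _).1 (inv_mem (ha' m hm))
        convert this using 1
        simp only [commutatorElement_def]; group }
  have hL : Subgroup.zpowers x ≤ L := by
    rw [Subgroup.zpowers_le]
    exact ⟨Subgroup.mem_normalizer_iff.2 hx, h⟩
  rw [Subgroup.commutator_comm, Subgroup.commutator_le]
  intro g hg m hm
  exact (hL hg).2 m hm

def PropK (Q : Type*) [Group Q] : Prop :=
  ∀ X : Subgroup Q, {S : Subgroup Q | ∃ H : Subgroup Q, S = ⁅X, H⁆}.Finite

theorem PropK.of_surj {Q P : Type*} [Group Q] [Group P] (h : PropK Q) (f : Q →* P)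
    (hf : Function.Surjective f) : PropK P := by
  intro X
  refine ((h (X.comap f)).image (Subgroup.map f)).subset ?_
  rintro _ ⟨H, rfl⟩
  refine ⟨_, ⟨H.comap f, rfl⟩, ?_⟩
  rw [Subgroup.map_commutator, Subgroup.map_comap_eq_self_of_surjective hf,
    Subgroup.map_comap_eq_self_of_surjective hf]

theorem aux_sup {Q : Type*} [Group Q] (C : Subgroup Q) (hC : ∀ a ∈ C, ∀ b ∈ C, a * b = b * a)
    (S : Set (Subgroup Q)) (hS : S.Finite) (h : ∀ H ∈ S, Finite H ∧ H ≤ C) :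
    Finite (sSup S : Subgroup Q) := by
  suffices Finite (sSup S : Subgroup Q) ∧ sSup S ≤ C from this.1
  induction S, hS using Set.Finite.induction_on with
  | empty => simp; infer_instance
  | insert ha hs ih =>
    rename_i K S
    obtain ⟨h1, h2⟩ := ih (fun H hH => h H (Set.mem_insert_of_mem _ hH))
    obtain ⟨h3, h4⟩ := h K (Set.mem_insert _ _)
    rw [sSup_insert]
    refine ⟨?_, sup_le h4 h2⟩
    have := Subgroup.coe_mul_of_left_le_normalizer_right K (sSup S) (by
      intro k hk
      rw [Subgroup.mem_normalizer_iff]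
      intro z
      constructor
      · intro hz
        rw [hC k (h4 hk) z (h2 hz)]; simpa using hz
      · intro hz
        have := hC k⁻¹ (inv_mem (h4 hk)) _ (h2 hz)
        have e : z = k * z * k⁻¹ := by
          calc z = k⁻¹ * (k * z * k⁻¹) * k := by group
            _ = _ := by rw [this]; group
        rw [e]; exact hz)
    have hf : ((K : Set Q) * ((sSup S : Subgroup Q) : Set Q)).Finite :=
      Set.Finite.mul (Set.toFinite (K : Set Q)) (Set.toFinite ((sSup S : Subgroup Q) : Set Q))
    rw [← this] at hf
    exact hf

theorem aux_combine {Q : Type*} [Group Q] (hK : PropK Q) (X Y : Subgroup Q)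
    (hC : ∀ a ∈ ⁅X, Y⁆, ∀ b ∈ ⁅X, Y⁆, a * b = b * a)
    (h : ∀ y ∈ Y, Finite (⁅X, Subgroup.zpowers y⁆ : Subgroup Q)) : Finite (⁅X, Y⁆ : Subgroup Q) := by
  have := aux_sup ⁅X, Y⁆ hC {S | ∃ y ∈ Y, S = ⁅X, Subgroup.zpowers y⁆}
    ((hK X).subset (by rintro _ ⟨y, _, rfl⟩; exact ⟨_, rfl⟩))
    (by
      rintro _ ⟨y, hy, rfl⟩
      exact ⟨h y hy, Subgroup.commutator_mono le_rfl (by simpa using hy)⟩)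
  refine Finite.Set.subset ((sSup {S | ∃ y ∈ Y, S = ⁅X, Subgroup.zpowers y⁆} : Subgroup Q) : Set Q) ?_
  show ⁅X, Y⁆ ≤ sSup _
  rw [Subgroup.commutator_le]
  intro a ha b hb
  exact (le_sSup (show ⁅X, Subgroup.zpowers b⁆ ∈ {S | ∃ y ∈ Y, S = ⁅X, Subgroup.zpowers y⁆} from ⟨b, hb, rfl⟩))
    (Subgroup.commutator_mem_commutator ha (Subgroup.mem_zpowers b))

theorem aux_ext {Q P : Type*} [Group Q] [Group P] (f : Q →* P) (hf : Finite f.ker)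
    (H : Subgroup Q) (h : Finite (H.map f)) : Finite H := by
  have h1 : (f ⁻¹' ((H.map f : Subgroup P) : Set P)).Finite := by
    refine Set.Finite.preimage' (Set.toFinite _) ?_
    intro b _
    by_cases hb : ∃ q, f q = b
    · obtain ⟨q, rfl⟩ := hb
      refine ((Set.toFinite (f.ker : Set Q)).image (fun z => q * z)).subset ?_
      intro z hz
      refine ⟨q⁻¹ * z, ?_, by simp⟩
      have : f z = f q := hz
      simp [MonoidHom.mem_ker, this]
    · convert Set.finite_empty
      ext z
      simp only [Set.mem_preimage, Set.mem_singleton_iff, Set.mem_empty_iff_false, iff_false]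
      exact fun hz => hb ⟨z, hz⟩
  exact (h1.subset (fun z hz => ⟨z, hz, rfl⟩) : (H : Set Q).Finite)

theorem aux_AA {Q R M : Type*} [Group Q] (hK : PropK Q) [CommRing R] [Algebra.FiniteType ℤ R]
    [AddCommGroup M] [Module R M] (x : Q) (j : Multiplicative M →* Q) (hj : Function.Injective j)
    (u v : R) (huv : v * u = 1)
    (hu : ∀ m : M, j (Multiplicative.ofAdd (u • m)) = x * j (Multiplicative.ofAdd m) * x⁻¹)
    (T : Subgroup Q) (δ : T →* Multiplicative M) (hδ : ∀ t : T, j (δ t) = ⁅x, (t : Q)⁆)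
    (B : Submodule R M) (hB : ∀ m, m ∈ B ↔ ∃ t, δ t = Multiplicative.ofAdd m) :
    Finite (⁅T, Subgroup.zpowers x⁆ : Subgroup Q) := by
  let S : Submodule R M → Subgroup Q := fun C => (AddSubgroup.toSubgroup C.toAddSubgroup).map j
  have hS : ∀ C q, q ∈ S C ↔ ∃ m ∈ C, j (Multiplicative.ofAdd m) = q := by
    intro C q
    constructor
    · rintro ⟨m, hm, rfl⟩
      exact ⟨m.toAdd, hm, rfl⟩
    · rintro ⟨m, hm, rfl⟩
      exact ⟨Multiplicative.ofAdd m, hm, rfl⟩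
  have hSj : ∀ C m, j m ∈ S C ↔ m.toAdd ∈ C := by
    intro C m
    rw [hS]
    constructor
    · rintro ⟨m', h1, h2⟩
      rw [← hj h2]; exact h1
    · intro h
      exact ⟨m.toAdd, h, rfl⟩
  have hSx : ∀ C c, c ∈ S C ↔ x * c * x⁻¹ ∈ S C := by
    intro C c
    constructor
    · intro h
      obtain ⟨m, hm, rfl⟩ := (hS C c).1 h
      rw [← hu, hSj]
      exact C.smul_mem u hm
    · intro h
      obtain ⟨m, hm, h2⟩ := (hS C _).1 h
      have h3 := hu (v • m)
      rw [smul_smul, mul_comm u v, huv, one_smul, h2] at h3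
      have h4 : c = j (Multiplicative.ofAdd (v • m)) := by simpa using h3
      rw [h4, hSj]
      exact C.smul_mem v hm
  have hinj : Function.Injective S := by
    intro C D h
    ext m
    have := hSj C (Multiplicative.ofAdd m)
    rw [h, hSj] at this
    exact this.symm
  have hfin : (Set.Iic B).Finite := by
    refine Set.Finite.of_finite_image ((hK (Subgroup.zpowers x)).subset ?_) hinj.injOn
    rintro _ ⟨C, hC, rfl⟩
    refine ⟨((AddSubgroup.toSubgroup C.toAddSubgroup).comap δ).map T.subtype, ?_⟩
    apply le_antisymm
    · intro q hq
      obtain ⟨m, hm, rfl⟩ := (hS C q).1 hq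
      obtain ⟨t, ht⟩ := (hB m).1 (hC hm)
      rw [← ht, hδ]
      refine Subgroup.commutator_mem_commutator (Subgroup.mem_zpowers x) ⟨t, ?_, rfl⟩
      show δ t ∈ AddSubgroup.toSubgroup C.toAddSubgroup
      rw [ht]
      exact hm
    · rw [Subgroup.commutator_comm]
      apply aux_zp _ _ _ (hSx C)
      rintro _ ⟨t, ht, rfl⟩
      show ⁅x, (t : Q)⁆ ∈ _
      rw [← hδ, hSj]
      exact ht
  have hBf : Finite B := aux_sub B hfin
  have hSB : ((S B : Subgroup Q) : Set Q).Finite := by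
    refine (Set.finite_range (fun b : B => j (Multiplicative.ofAdd b.1))).subset ?_
    intro q hq
    obtain ⟨m, hm, rfl⟩ := (hS B q).1 hq
    exact ⟨⟨m, hm⟩, rfl⟩
  refine hSB.subset (?_ : ⁅T, Subgroup.zpowers x⁆ ≤ S B)
  apply aux_zp _ _ _ (hSx B)
  intro t ht
  rw [← hδ ⟨t, ht⟩, hSj]
  exact (hB _).2 ⟨_, rfl⟩

theorem aux_A {Q : Type*} [Group Q] (hK : PropK Q) (A : Subgroup Q) (hn : A.Normal)
    (hA : ∀ a ∈ A, ∀ b ∈ A, a * b = b * a) (x : Q) :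
    Finite (⁅A, Subgroup.zpowers x⁆ : Subgroup Q) := by
  let instC : CommGroup A :=
    { (inferInstance : Group A) with mul_comm := fun a b => Subtype.ext (hA a a.2 b b.2) }
  let act : MulDistribMulAction (Multiplicative ℤ) A :=
    MulDistribMulAction.compHom A ((MulAut.conjNormal (H := A)).comp (zpowersHom Q x))
  let ρ := Representation.ofMulDistribMulAction (Multiplicative ℤ) A
  let g : Multiplicative ℤ := Multiplicative.ofAdd 1
  let u := MonoidAlgebra.of ℤ (Multiplicative ℤ) g
  let v := MonoidAlgebra.of ℤ (Multiplicative ℤ) g⁻¹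
  have huv : v * u = 1 := by
    simp only [u, v, ← map_mul, inv_mul_cancel, map_one]
  have hgact : ∀ a : A, ((g • a : A) : Q) = x * a * x⁻¹ := by
    intro a
    show ((MulAut.conjNormal (zpowersHom Q x g) a : A) : Q) = _
    rw [MulAut.conjNormal_apply]
    simp [g, zpowersHom_apply]
  have hum : ∀ a : A, u • ρ.asModuleEquiv.symm (Additive.ofMul a)
      = ρ.asModuleEquiv.symm (Additive.ofMul (g • a)) := by
    intro a
    rw [← Representation.asModuleEquiv_symm_map_rho]
    rfl
  let j : Multiplicative ρ.asModule →* Q :=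
    { toFun := fun m => (((ρ.asModuleEquiv m.toAdd).toMul : A) : Q)
      map_one' := rfl
      map_mul' := fun _ _ => rfl }
  let δ : A →* Multiplicative ρ.asModule :=
    { toFun := fun t => Multiplicative.ofAdd ((u - 1) • ρ.asModuleEquiv.symm (Additive.ofMul t))
      map_one' := by
        rw [ofMul_one, map_zero, smul_zero]; rfl
      map_mul' := fun s t => by
        rw [ofMul_mul, map_add, smul_add]; rfl }
  have hfg : Monoid.FG (Multiplicative ℤ) := inferInstance
  have hft : @Algebra.FiniteType ℤ (MonoidAlgebra ℤ (Multiplicative ℤ)) _ _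
      (Ring.toIntAlgebra _) := by
    have h1 : Algebra.FiniteType ℤ (MonoidAlgebra ℤ (Multiplicative ℤ)) :=
      MonoidAlgebra.finiteType_of_fg
    have e : (Ring.toIntAlgebra (MonoidAlgebra ℤ (Multiplicative ℤ))) =
        (MonoidAlgebra.algebra : Algebra ℤ (MonoidAlgebra ℤ (Multiplicative ℤ))) :=
      Subsingleton.elim _ _
    rw [e]
    exact h1
  refine aux_AA hK x j ?_ u v huv ?_ A δ ?_
    (LinearMap.range (LinearMap.lsmul (MonoidAlgebra ℤ (Multiplicative ℤ)) ρ.asModule (u - 1))) ?_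
  · intro a b h
    exact Multiplicative.toAdd.injective (Additive.toMul.injective (Subtype.ext h))
  · intro m
    have h1 := hum (ρ.asModuleEquiv m).toMul
    have h2 := hgact (ρ.asModuleEquiv m).toMul
    rw [ofMul_toMul, LinearEquiv.symm_apply_apply] at h1
    rw [h1]
    exact h2
  · intro t
    show j (Multiplicative.ofAdd ((u - 1) • ρ.asModuleEquiv.symm (Additive.ofMul t))) = _
    rw [sub_smul, one_smul, hum, ofAdd_sub, map_div]
    show ((g • t : A) : Q) / (t : Q) = _
    rw [hgact, commutatorElement_def, div_eq_mul_inv]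
  · intro m
    constructor
    · rintro ⟨m', rfl⟩
      exact ⟨(ρ.asModuleEquiv m').toMul, rfl⟩
    · rintro ⟨t, ht⟩
      exact ⟨ρ.asModuleEquiv.symm (Additive.ofMul t), ht⟩

theorem aux_C {Q : Type*} [Group Q] (hK : PropK Q) (T : Subgroup Q)
    (hT : ⁅T, T⁆ ≤ Subgroup.center Q) (x : Q) (hx : x ∈ T) :
    Finite (⁅T, Subgroup.zpowers x⁆ : Subgroup Q) := by
  let instC : CommGroup (Subgroup.center Q) :=
    { (inferInstance : Group (Subgroup.center Q)) with
      mul_comm := fun a b => Subtype.ext (Subgroup.mem_center_iff.1 b.2 a) }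
  let δ : T →* Multiplicative (Additive (Subgroup.center Q)) :=
    { toFun := fun t => Multiplicative.ofAdd (Additive.ofMul
        ⟨⁅x, (t : Q)⁆, hT (Subgroup.commutator_mem_commutator hx t.2)⟩)
      map_one' := by
        apply Multiplicative.toAdd.injective
        apply Additive.toMul.injective
        apply Subtype.ext
        simp
      map_mul' := by
        intro s t
        apply Multiplicative.toAdd.injective
        apply Additive.toMul.injective
        apply Subtype.ext
        have h1 := Subgroup.mem_center_iff.1 (hT (Subgroup.commutator_mem_commutator hx t.2))
        have h2 := h1 s
        show ⁅x, (s : Q) * t⁆ = ⁅x, (s : Q)⁆ * ⁅x, (t : Q)⁆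
        calc _ = ⁅x, (s : Q)⁆ * (s * ⁅x, (t : Q)⁆ * (s : Q)⁻¹) := by
              simp only [commutatorElement_def]; group
          _ = _ := by rw [h2]; group }
  let j : Multiplicative (Additive (Subgroup.center Q)) →* Q :=
    { toFun := fun m => ((m.toAdd.toMul : Subgroup.center Q) : Q)
      map_one' := rfl
      map_mul' := fun _ _ => rfl }
  let B : AddSubgroup (Additive (Subgroup.center Q)) :=
    { carrier := {m | ∃ t, δ t = Multiplicative.ofAdd m}
      zero_mem' := ⟨1, map_one δ⟩
      add_mem' := by
        rintro a b ⟨s, hs⟩ ⟨t, ht⟩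
        exact ⟨s * t, by rw [map_mul, hs, ht]; rfl⟩
      neg_mem' := by
        rintro a ⟨s, hs⟩
        exact ⟨s⁻¹, by rw [map_inv, hs]; rfl⟩ }
  refine aux_AA hK x j ?_ (1 : ℤ) 1 (by norm_num) ?_ T δ (fun t => rfl)
    (AddSubgroup.toIntSubmodule (M := Additive (Subgroup.center Q)) B) ?_
  · intro a b h
    exact Multiplicative.toAdd.injective (Additive.toMul.injective (Subtype.ext h))
  · intro m
    rw [one_smul]
    have := Subgroup.mem_center_iff.1 (m.toMul : Subgroup.center Q).2 x
    show ((m.toMul : Subgroup.center Q) : Q) = x * ((m.toMul : Subgroup.center Q) : Q) * x⁻¹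
    rw [this]; group
  · intro m
    exact Iff.rfl

theorem aux_quot {Q : Type*} [Group Q] (F T : Subgroup Q) [F.Normal] (hF : Finite F)
    (h : Finite (⁅T.map (QuotientGroup.mk' F), ⊤⁆ : Subgroup (Q ⧸ F))) :
    Finite (⁅T, ⊤⁆ : Subgroup Q) := by
  apply aux_ext (QuotientGroup.mk' F)
  · rw [QuotientGroup.ker_mk']; exact hF
  · rw [Subgroup.map_commutator,
      Subgroup.map_top_of_surjective _ (QuotientGroup.mk'_surjective F)]
    exact h

theorem aux_map_comm {Q : Type*} [Group Q] (F X Y : Subgroup Q) [F.Normal] (h : ⁅X, Y⁆ ≤ F) :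
    (⁅X.map (QuotientGroup.mk' F), Y.map (QuotientGroup.mk' F)⁆ : Subgroup (Q ⧸ F)) = ⊥ := by
  rw [← Subgroup.map_commutator, Subgroup.map_eq_bot_iff, QuotientGroup.ker_mk']
  exact h

theorem aux_abel {Q : Type*} [Group Q] (hK : PropK Q) (T : Subgroup Q) (hn : T.Normal)
    (h : ⁅T, T⁆ = ⊥) : Finite (⁅T, ⊤⁆ : Subgroup Q) := by
  have hA : ∀ a ∈ T, ∀ b ∈ T, a * b = b * a := by
    intro a ha b hb
    have := Subgroup.commutator_mem_commutator ha hb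
    rw [h, Subgroup.mem_bot] at this
    exact commutatorElement_eq_one_iff_mul_comm.1 this
  have hle : ⁅T, ⊤⁆ ≤ T := Subgroup.commutator_le_left T ⊤
  exact aux_combine hK T ⊤ (fun a ha b hb => hA a (hle ha) b (hle hb))
    (fun y _ => aux_A hK T hn hA y)

theorem aux_central {Q : Type*} [Group Q] (T : Subgroup Q) (h : ⁅T, (⊤ : Subgroup Q)⁆ = ⊥) :
    T ≤ Subgroup.center Q := by
  intro t ht
  rw [Subgroup.mem_center_iff]
  intro q
  have := Subgroup.commutator_mem_commutator ht (Subgroup.mem_top q)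
  rw [h, Subgroup.mem_bot] at this
  exact (commutatorElement_eq_one_iff_mul_comm.1 this).symm

theorem aux_class2 {Q : Type*} [Group Q] (hK : PropK Q) (T : Subgroup Q) (hn : T.Normal)
    (h : ⁅T, T⁆ ≤ Subgroup.center Q) : Finite (⁅T, ⊤⁆ : Subgroup Q) := by
  have hfin : Finite (⁅T, T⁆ : Subgroup Q) :=
    aux_combine hK T T (fun a ha b _ => (Subgroup.mem_center_iff.1 (h ha) b).symm)
      (fun y hy => aux_C hK T h y hy)
  apply aux_quot ⁅T, T⁆ T hfin
  apply aux_abel (hK.of_surj _ (QuotientGroup.mk'_surjective _))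
  · exact hn.map _ (QuotientGroup.mk'_surjective _)
  · exact aux_map_comm _ _ _ le_rfl

theorem aux_step {Q : Type*} [Group Q] (hK : PropK Q) (T : Subgroup Q) (hn : T.Normal)
    (h : Finite (⁅⁅T, T⁆, ⊤⁆ : Subgroup Q)) : Finite (⁅T, ⊤⁆ : Subgroup Q) := by
  apply aux_quot ⁅⁅T, T⁆, ⊤⁆ T h
  apply aux_class2 (hK.of_surj _ (QuotientGroup.mk'_surjective _))
  · exact hn.map _ (QuotientGroup.mk'_surjective _)
  · apply aux_central
    have := aux_map_comm ⁅⁅T, T⁆, (⊤ : Subgroup Q)⁆ ⁅T, T⁆ ⊤ le_rfl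
    rwa [Subgroup.map_commutator, 
      Subgroup.map_top_of_surjective _ (QuotientGroup.mk'_surjective _)] at this

theorem aux_main {Q : Type*} [Group Q] (hK : PropK Q) (S : Subgroup Q) (hn : S.Normal)
    (hs : IsSolvable S) (hf : S.FiniteIndex) : Finite (commutator Q) := by
  have hnorm : ∀ k, ((derivedSeries S k).map S.subtype).Normal := by
    intro k
    induction k with
    | zero =>
      rw [derivedSeries_zero, ← MonoidHom.range_eq_map, Subgroup.range_subtype]
      exact hn
    | succ k ih =>
      rw [derivedSeries_succ, Subgroup.map_commutator]
      exact Subgroup.commutator_normal _ _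
  obtain ⟨n, hn0⟩ := hs.solvable
  have key : ∀ k, Finite (⁅(derivedSeries S (n - k)).map S.subtype, ⊤⁆ : Subgroup Q) := by
    intro k
    induction k with
    | zero =>
      rw [Nat.sub_zero, hn0, Subgroup.map_bot, Subgroup.commutator_bot_left]
      infer_instance
    | succ k ih =>
      by_cases hk : n ≤ k
      · rwa [show n - (k + 1) = n - k by omega]
      · apply aux_step hK _ (hnorm _)
        rw [← Subgroup.map_commutator, ← derivedSeries_succ,
          show n - (k + 1) + 1 = n - k by omega]
        exact ih
  have h0 := key n
  rw [Nat.sub_self, derivedSeries_zero, ← MonoidHom.range_eq_map, Subgroup.range_subtype] at h0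
  apply aux_ext (QuotientGroup.mk' ⁅S, (⊤ : Subgroup Q)⁆)
  · rw [QuotientGroup.ker_mk']; exact h0
  · have hfi : (S.map (QuotientGroup.mk' ⁅S, (⊤ : Subgroup Q)⁆)).FiniteIndex :=
      ⟨fun h => hf.index_ne_zero (Nat.eq_zero_of_zero_dvd (h ▸
        S.index_map_dvd (QuotientGroup.mk'_surjective _)))⟩
    have := aux_schur (S.map (QuotientGroup.mk' ⁅S, (⊤ : Subgroup Q)⁆)) (by
      apply aux_central
      have := aux_map_comm ⁅S, (⊤ : Subgroup Q)⁆ S ⊤ le_rfl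
      rwa [Subgroup.map_top_of_surjective _ (QuotientGroup.mk'_surjective _)] at this)
    rw [commutator_def, Subgroup.map_commutator,
      Subgroup.map_top_of_surjective _ (QuotientGroup.mk'_surjective _)]
    exact this

theorem stmt_13 (G : Type*) [Group G] (hsf : SolubleByFinite G)
    (hG : PropKInf G) (N : Subgroup G) (hnorm : N.Normal) (hinf : Infinite N) :
    Finite (commutator (G ⧸ N)) := by
  obtain ⟨S, hSn, hSs, hSf⟩ := hsf
  have hsurj := QuotientGroup.mk'_surjective N
  have hK : PropK (G ⧸ N) := by
    intro X
    refine ((hG (X.comap (QuotientGroup.mk' N))).image (Subgroup.map (QuotientGroup.mk' N))).subset ?_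
    rintro _ ⟨H, rfl⟩
    refine ⟨_, ⟨H.comap (QuotientGroup.mk' N), ?_, rfl⟩, ?_⟩
    · have hle : N ≤ H.comap (QuotientGroup.mk' N) := by
        intro z hz
        have : QuotientGroup.mk' N z = 1 := (QuotientGroup.eq_one_iff z).2 hz
        rw [Subgroup.mem_comap, this]
        exact one_mem H
      exact Infinite.of_injective _ (Subgroup.inclusion_injective hle)
    · rw [Subgroup.map_commutator, Subgroup.map_comap_eq_self_of_surjective hsurj,
        Subgroup.map_comap_eq_self_of_surjective hsurj]
  refine aux_main hK (S.map (QuotientGroup.mk' N)) (hSn.map _ hsurj) ?_ ?_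
  · have : Group.IsSolvable S := hSs
    exact Group.isSolvable_of_surjective ((QuotientGroup.mk' N).subgroupMap_surjective S)
  · exact ⟨fun h => hSf.index_ne_zero (Nat.eq_zero_of_zero_dvd (h ▸ S.index_map_dvd hsurj))⟩
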